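/- Let Q = (x_1,x_2) × (t_1,t_2) ⊂ ℝ² be an open rectangle with x_2 > x_1 and t_2 > t_1. Given any λ_1 > 0, λ_2 > 0 and ε > 0, there exists a function ω = (φ,ψ) ∈ C_c^∞(Q; ℝ²) such that: (a) ‖ω‖_{L^∞(Q)} < ε, ‖φ_t‖_{L^∞(Q)} < ε, ‖ψ_t‖_{L^∞(Q)} < ε; (b) −λ_1 ≤ φ_x ≤ λ_2 in Q; (c) | |{(x,t) ∈ Q : φ_x(x,t) = −λ_1}| − (λ_2/(λ_1+λ_2))|Q| | < ε and | |{(x,t) ∈ Q : φ_x(x,t) = λ_2}| − (λ_1/(λ_1+λ_2))|Q| | < ε, where |·| denotes two-dimensional Lebesgue measure; (d) ψ_x = φ in Q; and (e) ∫_{x_1}^{x_2} φ(x,t) dx = 0 for all t ∈ (t_1,t_2). -/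

import Mathlib

open MeasureTheory Set Filter Topology
open scoped ENNReal NNReal

noncomputable section

/-- Partial derivative in the spatial variable `x`. -/
def pdx (u : ℝ → ℝ → ℝ) : ℝ → ℝ → ℝ := fun x t => deriv (fun y => u y t) x

/-- Partial derivative in the time variable `t`. -/
def pdt (u : ℝ → ℝ → ℝ) : ℝ → ℝ → ℝ := fun x t => deriv (fun s => u x s) t

/-- Uncurried version of a function of two real variables. -/
def uc (u : ℝ → ℝ → ℝ) : ℝ × ℝ → ℝ := fun p => u p.1 p.2

/-- `g` is a one-dimensional laminate on `(a, b)` with first derivative `f` and second derivative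
`k`: it is compactly supported in `(a, b)`, `g` and `f` are bounded by `δ`, and `k` takes values in
`[-l, m]`, the extreme values being attained on almost the largest possible sets. -/
structure IsLaminate (l m δ a b : ℝ) (g f k : ℝ → ℝ) : Prop where
  contDiff : ContDiff ℝ (⊤ : ℕ∞) k
  hasDerivAt : ∀ x, HasDerivAt g (f x) x
  hasDerivAt' : ∀ x, HasDerivAt f (k x) x
  tsupport_subset : tsupport g ⊆ Ioo a b
  abs_le : ∀ x, |g x| ≤ δ
  abs_le' : ∀ x, |f x| ≤ δ
  mem_Icc : ∀ x, k x ∈ Icc (-l) m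
  le_volume_lower : (1 - δ) * (m / (l + m)) * (b - a) ≤ volume.real {x | x ∈ Ioo a b ∧ k x = -l}
  le_volume_upper : (1 - δ) * (l / (l + m)) * (b - a) ≤ volume.real {x | x ∈ Ioo a b ∧ k x = m}

theorem contDiff_infty_of_hasDerivAt {f f' : ℝ → ℝ} (h : ∀ x, HasDerivAt f (f' x) x)
    (hf' : ContDiff ℝ (⊤ : ℕ∞) f') : ContDiff ℝ (⊤ : ℕ∞) f := by
  refine contDiff_infty_iff_deriv.2 ⟨fun x => (h x).differentiableAt, ?_⟩
  rwa [show deriv f = f' from funext fun x => (h x).deriv]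

theorem tsupport_subset_of_hasDerivAt {f f' : ℝ → ℝ} (h : ∀ x, HasDerivAt f (f' x) x) :
    tsupport f' ⊆ tsupport f := by
  rw [← show deriv f = f' from funext fun x => (h x).deriv]
  exact closure_minimal support_deriv_subset (isClosed_tsupport f)

namespace IsLaminate

variable {l m δ a b c : ℝ} {g f k g' f' k' : ℝ → ℝ}

theorem tsupport_subset' (h : IsLaminate l m δ a b g f k) : tsupport f ⊆ Ioo a b :=
  (tsupport_subset_of_hasDerivAt h.hasDerivAt).trans h.tsupport_subset

theorem tsupport_subset'' (h : IsLaminate l m δ a b g f k) : tsupport k ⊆ Ioo a b :=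
  (tsupport_subset_of_hasDerivAt h.hasDerivAt').trans h.tsupport_subset'

theorem eq_zero (h : IsLaminate l m δ a b g f k) {x : ℝ} (hx : x ∉ Ioo a b) :
    g x = 0 ∧ f x = 0 ∧ k x = 0 :=
  ⟨image_eq_zero_of_notMem_tsupport fun h' => hx (h.tsupport_subset h'),
    image_eq_zero_of_notMem_tsupport fun h' => hx (h.tsupport_subset' h'),
    image_eq_zero_of_notMem_tsupport fun h' => hx (h.tsupport_subset'' h')⟩

theorem measurableSet (h : IsLaminate l m δ a b g f k) (v : ℝ) :
    MeasurableSet {x | x ∈ Ioo a b ∧ k x = v} :=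
  measurableSet_Ioo.inter (h.contDiff.continuous.measurable (measurableSet_singleton v))

theorem volume_add_volume_le (h : IsLaminate l m δ a b g f k) (h' : IsLaminate l m δ b c g' f' k')
    (hab : a ≤ b) (hbc : b ≤ c) (v : ℝ) :
    volume.real {x | x ∈ Ioo a b ∧ k x = v} + volume.real {x | x ∈ Ioo b c ∧ k' x = v} ≤
      volume.real {x | x ∈ Ioo a c ∧ k x + k' x = v} := by
  have hfin {a b : ℝ} {p : ℝ → Prop} : volume {x | x ∈ Ioo a b ∧ p x} ≠ ∞ :=
    measure_ne_top_of_subset (fun x hx => hx.1) (measure_Ioo_lt_top (a := a) (b := b)).ne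
  rw [← measureReal_union _ (h'.measurableSet v) hfin hfin]
  · refine measureReal_mono ?_ hfin
    rintro x (⟨hx, rfl⟩ | ⟨hx, rfl⟩)
    · refine ⟨⟨hx.1, hx.2.trans_le hbc⟩, ?_⟩
      rw [(h'.eq_zero fun h0 => h0.1.not_gt hx.2).2.2, add_zero]
    · refine ⟨⟨hab.trans_lt hx.1, hx.2⟩, ?_⟩
      rw [(h.eq_zero fun h0 => h0.2.not_gt hx.1).2.2, zero_add]
  · exact Set.disjoint_left.2 fun x hx hx' => hx.1.2.not_gt hx'.1.1

theorem add (h : IsLaminate l m δ a b g f k) (h' : IsLaminate l m δ b c g' f' k')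
    (hab : a ≤ b) (hbc : b ≤ c) :
    IsLaminate l m δ a c (fun x => g x + g' x) (fun x => f x + f' x) (fun x => k x + k' x) := by
  have key (x : ℝ) : (g x = 0 ∧ f x = 0 ∧ k x = 0) ∨ (g' x = 0 ∧ f' x = 0 ∧ k' x = 0) := by
    rcases lt_or_ge x b with hx | hx
    · exact Or.inr (h'.eq_zero fun h0 => h0.1.not_gt hx)
    · exact Or.inl (h.eq_zero fun h0 => h0.2.not_ge hx)
  refine ⟨h.contDiff.add h'.contDiff, fun x => (h.hasDerivAt x).add (h'.hasDerivAt x),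
    fun x => (h.hasDerivAt' x).add (h'.hasDerivAt' x), ?_, fun x => ?_, fun x => ?_, fun x => ?_,
    ?_, ?_⟩
  · refine (tsupport_add g g').trans (union_subset (h.tsupport_subset.trans ?_)
      (h'.tsupport_subset.trans ?_))
    · exact Ioo_subset_Ioo_right hbc
    · exact Ioo_subset_Ioo_left hab
  · rcases key x with hx | hx
    · simpa [hx.1] using h'.abs_le x
    · simpa [hx.1] using h.abs_le x
  · rcases key x with hx | hx
    · simpa [hx.2.1] using h'.abs_le' x
    · simpa [hx.2.1] using h.abs_le' x
  · rcases key x with hx | hx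
    · simpa only [hx.2.2, zero_add] using h'.mem_Icc x
    · simpa only [hx.2.2, add_zero] using h.mem_Icc x
  · linarith [h.le_volume_lower, h'.le_volume_lower, h.volume_add_volume_le h' hab hbc (-l)]
  · linarith [h.le_volume_upper, h'.le_volume_upper, h.volume_add_volume_le h' hab hbc m]

theorem comp_sub_const (h : IsLaminate l m δ a b g f k) (c : ℝ) :
    IsLaminate l m δ (a + c) (b + c) (fun x => g (x - c)) (fun x => f (x - c))
      (fun x => k (x - c)) := by
  have hvol (v : ℝ) : volume.real {x | x ∈ Ioo (a + c) (b + c) ∧ k (x - c) = v} =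
      volume.real {x | x ∈ Ioo a b ∧ k x = v} := by
    rw [measureReal_def, measureReal_def,
      ← measure_preimage_add_right volume (-c) {x | x ∈ Ioo a b ∧ k x = v}]
    congr 2
    ext x
    simp [← sub_eq_add_neg, lt_sub_iff_add_lt, sub_lt_iff_lt_add]
  refine ⟨h.contDiff.comp (contDiff_id.sub contDiff_const),
    fun x => (h.hasDerivAt (x - c)).comp_sub_const x c,
    fun x => (h.hasDerivAt' (x - c)).comp_sub_const x c, ?_, fun x => h.abs_le _,
    fun x => h.abs_le' _, fun x => h.mem_Icc _, ?_, ?_⟩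
  · intro x hx
    have := h.tsupport_subset (tsupport_comp_subset_preimage g
      (show Continuous fun x : ℝ => x - c by fun_prop) hx)
    exact ⟨lt_sub_iff_add_lt.1 this.1, sub_lt_iff_lt_add.1 this.2⟩
  · rw [hvol]; linarith [h.le_volume_lower]
  · rw [hvol]; linarith [h.le_volume_upper]

end IsLaminate

theorem abs_le_mul_of_hasDerivAt_of_eq_zero {f f' : ℝ → ℝ} (h : ∀ x, HasDerivAt f (f' x) x)
    {C r : ℝ} (hC : ∀ x, |f' x| ≤ C) (hf : ∀ x, r ≤ |x| → f x = 0) (hr : 0 < r) (x : ℝ) :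
    |f x| ≤ C * (2 * r) := by
  have hC0 : 0 ≤ C := (abs_nonneg _).trans (hC 0)
  rcases le_or_gt r |x| with hx | hx
  · rw [hf x hx, abs_zero]; positivity
  · have := convex_univ.norm_image_sub_le_of_norm_hasDerivWithin_le
      (fun y _ => (h y).hasDerivWithinAt) (fun y _ => hC y) (mem_univ (-r)) (mem_univ x)
    rw [hf (-r) (by rw [abs_neg, abs_of_pos hr]), sub_zero, Real.norm_eq_abs, Real.norm_eq_abs,
      sub_neg_eq_add] at this
    rw [abs_lt] at hx
    rw [abs_of_pos (by linarith : 0 < x + r)] at this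
    exact this.trans (mul_le_mul_of_nonneg_left (by linarith) hC0)

/-- An odd function supported in `[-r, r]` has an antiderivative supported in `[-r, r]`. -/
theorem exists_antideriv_of_odd {f : ℝ → ℝ} (hf : Continuous f) (hodd : ∀ x, f (-x) = -f x)
    {r : ℝ} (h0 : ∀ x, r ≤ |x| → f x = 0) :
    ∃ g : ℝ → ℝ, (∀ x, HasDerivAt g (f x) x) ∧ ∀ x, r ≤ |x| → g x = 0 := by
  refine ⟨fun x => ∫ y in (-r)..x, f y, fun x => hf.integral_hasStrictDerivAt _ x |>.hasDerivAt,
    fun x hx => ?_⟩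
  have hsymm (x : ℝ) : ∫ y in (-x)..x, f y = 0 := by
    have h1 := intervalIntegral.integral_comp_neg (a := -x) (b := x) f
    simp only [hodd, intervalIntegral.integral_neg, neg_neg] at h1
    linarith
  have hzero {u v : ℝ} (h : ∀ y ∈ uIcc u v, r ≤ |y|) : ∫ y in u..v, f y = 0 := by
    rw [intervalIntegral.integral_congr (g := fun _ => (0 : ℝ)) fun y hy => h0 y (h y hy)]
    simp
  have hint (u v : ℝ) : IntervalIntegrable f volume u v := hf.intervalIntegrable u v
  change ∫ y in (-r)..x, f y = 0
  rcases le_abs.1 hx with h | h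
  · rw [← intervalIntegral.integral_add_adjacent_intervals (hint _ r) (hint r x), hsymm,
      hzero fun y hy => ?_, add_zero]
    rw [uIcc_of_le h] at hy
    exact hy.1.trans (le_abs_self y)
  · refine hzero fun y hy => ?_
    rw [uIcc_of_ge (by linarith)] at hy
    exact le_abs.2 (Or.inr (by linarith [hy.2]))

/-- A single cell, on the interval `(-r, r)`. -/
theorem exists_isLaminate_symm {l m δ r : ℝ} (hl : 0 < l) (hm : 0 < m) (hδ : 0 < δ) (hr : 0 < r)
    (hr1 : 2 * r ≤ 1) (hrδ : (l + m) * (2 * r) ≤ δ) :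
    ∃ g f k, IsLaminate l m δ (-r) r g f k := by
  have hlm : 0 < l + m := by positivity
  obtain ⟨s, hs⟩ : ∃ s, s = m / (l + m) := ⟨_, rfl⟩
  have hs0 : 0 < s := by rw [hs]; positivity
  have hs' : l / (l + m) = 1 - s := by rw [hs]; field_simp; ring
  have hs1 : 0 < 1 - s := by rw [← hs']; positivity
  have hms : m / s = l + m := by rw [hs]; field_simp
  obtain ⟨η, hη0, hηδ, hη1⟩ : ∃ η, 0 < η ∧ η ≤ δ * (1 - s) ∧ η < 1 - s := by
    refine ⟨min δ (1 / 2) * (1 - s), by positivity, ?_, ?_⟩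
    · gcongr; exact min_le_left _ _
    · nlinarith [min_le_right δ (1 / 2)]
  let χ : ContDiffBump (0 : ℝ) :=
    ⟨r * (1 - η), r * (1 - η / 2), by have : 0 < 1 - η := by linarith
                                      positivity, by nlinarith⟩
  have hin : χ.rIn = r * (1 - η) := rfl
  have hout : χ.rOut = r * (1 - η / 2) := rfl
  have hsin : s * χ.rOut ≤ χ.rIn := by
    rw [hin, hout]
    have : 0 ≤ r * s * η := by positivity
    nlinarith
  have hone {x : ℝ} (hx : |x| ≤ χ.rIn) : χ x = 1 :=
    χ.one_of_mem_closedBall (by simpa using hx)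
  have hzero {x : ℝ} (hx : χ.rOut ≤ |x|) : χ x = 0 := χ.zero_of_le_dist (by simpa using hx)
  have hdiv {x y : ℝ} : y ≤ |x / s| ↔ s * y ≤ |x| := by
    rw [abs_div, abs_of_pos hs0, le_div_iff₀ hs0, mul_comm]
  have hdiv' {x y : ℝ} : |x / s| ≤ y ↔ |x| ≤ s * y := by
    rw [abs_div, abs_of_pos hs0, div_le_iff₀ hs0, mul_comm]
  let X : ℝ → ℝ := fun x => ∫ y in (0 : ℝ)..x, χ y
  have hX (x : ℝ) : HasDerivAt X (χ x) x :=
    (χ.continuous.integral_hasStrictDerivAt _ x).hasDerivAt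
  have hXodd (x : ℝ) : X (-x) = -X x := by
    have h1 := intervalIntegral.integral_comp_neg (a := 0) (b := x) χ
    simp only [χ.neg, neg_zero] at h1
    rw [show X x = ∫ y in (0 : ℝ)..x, χ y from rfl, h1, intervalIntegral.integral_symm, neg_neg]
  have hXconst {x : ℝ} (hx : χ.rOut ≤ x) : X x = X χ.rOut := by
    have hi (u v : ℝ) : IntervalIntegrable χ volume u v := χ.continuous.intervalIntegrable u v
    change ∫ y in (0 : ℝ)..x, χ y = ∫ y in (0 : ℝ)..χ.rOut, χ y
    rw [← intervalIntegral.integral_add_adjacent_intervals (hi 0 χ.rOut) (hi χ.rOut x),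
      intervalIntegral.integral_congr (a := χ.rOut) (g := fun _ => (0 : ℝ)) fun y hy => ?_]
    · simp
    · rw [uIcc_of_le hx] at hy
      exact hzero (hy.1.trans (le_abs_self y))
  let f : ℝ → ℝ := fun x => m * (X x - X (x / s))
  let k : ℝ → ℝ := fun x => m * χ x - (l + m) * χ (x / s)
  have hfk (x : ℝ) : HasDerivAt f (k x) x := by
    have h1 : HasDerivAt (fun x => X (x / s)) (χ (x / s) * (1 / s)) x :=
      HasDerivAt.comp (h := fun x => x / s) x (hX (x / s)) ((hasDerivAt_id x).div_const s)
    refine (((hX x).sub h1).const_mul m).congr_deriv ?_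
    change _ = m * χ x - (l + m) * χ (x / s)
    rw [← hms]; ring
  have hfodd (x : ℝ) : f (-x) = -f x := by
    change m * (X (-x) - X (-x / s)) = -(m * (X x - X (x / s)))
    rw [neg_div, hXodd, hXodd]; ring
  have hf0 (x : ℝ) (hx : χ.rOut ≤ |x|) : f x = 0 := by
    have hpos {x : ℝ} (hx : χ.rOut ≤ x) : f x = 0 := by
      have h1 : χ.rOut ≤ x / s := by
        rw [le_div_iff₀ hs0]
        nlinarith [χ.rOut_pos]
      change m * (X x - X (x / s)) = 0
      rw [hXconst hx, hXconst h1, sub_self, mul_zero]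
    rcases le_abs.1 hx with h | h
    · exact hpos h
    · rw [← neg_neg x, hfodd, hpos h, neg_zero]
  have hfcont : Continuous f := continuous_iff_continuousAt.2 fun x => (hfk x).continuousAt
  obtain ⟨g, hg, hg0⟩ := exists_antideriv_of_odd hfcont hfodd hf0
  have hk (x : ℝ) : k x ∈ Icc (-l) m := by
    change m * χ x - (l + m) * χ (x / s) ∈ _
    rcases le_total χ.rOut |x / s| with hx | hx
    · rw [hzero hx]
      constructor <;> nlinarith [χ.nonneg (x := x), χ.le_one (x := x)]
    · rw [hone ((hdiv'.1 hx).trans hsin)]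
      constructor <;> nlinarith [χ.nonneg (x := x / s), χ.le_one (x := x / s)]
  have hrr : χ.rOut < r := by rw [hout]; nlinarith
  have hkabs (x : ℝ) : |k x| ≤ l + m :=
    abs_le.2 ⟨by linarith [(hk x).1], by linarith [(hk x).2]⟩
  have hfabs (x : ℝ) : |f x| ≤ δ :=
    (abs_le_mul_of_hasDerivAt_of_eq_zero hfk hkabs (fun x hx => hf0 x (hrr.le.trans hx)) hr x).trans
      hrδ
  have hgabs (x : ℝ) : |g x| ≤ δ :=
    (abs_le_mul_of_hasDerivAt_of_eq_zero hg hfabs (fun x hx => hg0 x (hrr.le.trans hx)) hr x).trans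
      (mul_le_of_le_one_right hδ.le hr1)
  have hfin {p : ℝ → Prop} : volume {x | x ∈ Ioo (-r) r ∧ p x} ≠ ∞ :=
    measure_ne_top_of_subset (fun x hx => hx.1) (measure_Ioo_lt_top (a := -r) (b := r)).ne
  refine ⟨g, f, k, ?_, hg, hfk, ?_, hgabs, hfabs, hk, ?_, ?_⟩
  · exact (contDiff_const.mul χ.contDiff).sub
      (contDiff_const.mul (χ.contDiff.comp (contDiff_id.div_const s)))
  · have hsub : Function.support g ⊆ Icc (-χ.rOut) χ.rOut := fun x hx =>
      abs_le.1 (le_of_not_ge fun h => hx (hg0 x h))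
    exact (closure_minimal hsub isClosed_Icc).trans
      (Icc_subset_Ioo (neg_lt_neg hrr) hrr)
  · rw [← hs]
    have hsub : Icc (-(s * χ.rIn)) (s * χ.rIn) ⊆ {x | x ∈ Ioo (-r) r ∧ k x = -l} := by
      intro x hx
      have h1 : |x| ≤ s * χ.rIn := abs_le.2 hx
      have h2 : |x| ≤ χ.rIn := h1.trans (by nlinarith [χ.rIn_pos])
      refine ⟨abs_lt.1 (h2.trans_lt (χ.rIn_lt_rOut.trans hrr)), ?_⟩
      change m * χ x - (l + m) * χ (x / s) = -l
      rw [hone h2, hone (hdiv'.2 h1)]; ring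
    have hpos := mul_pos hs0 χ.rIn_pos
    refine le_trans ?_ (measureReal_mono hsub hfin)
    rw [Real.volume_real_Icc_of_le (by linarith), hin]
    have : η ≤ δ := by nlinarith
    have : 0 < s * r := by positivity
    nlinarith
  · rw [hs']
    have hsub : Icc (-χ.rIn) (-(s * χ.rOut)) ∪ Ioc (s * χ.rOut) χ.rIn ⊆
        {x | x ∈ Ioo (-r) r ∧ k x = m} := by
      intro x hx
      have hpos := mul_pos hs0 χ.rOut_pos
      have h1 : |x| ≤ χ.rIn := by
        rcases hx with hx | hx
        · exact abs_le.2 ⟨hx.1, by linarith [hx.2, χ.rIn_pos]⟩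
        · exact abs_le.2 ⟨by linarith [hx.1, χ.rIn_pos], hx.2⟩
      have h2 : s * χ.rOut ≤ |x| := by
        rcases hx with hx | hx
        · exact le_abs.2 (Or.inr (by linarith [hx.2]))
        · exact le_abs.2 (Or.inl hx.1.le)
      refine ⟨abs_lt.1 (h1.trans_lt (χ.rIn_lt_rOut.trans hrr)), ?_⟩
      change m * χ x - (l + m) * χ (x / s) = m
      rw [hone h1, hzero (hdiv.2 h2)]; ring
    have hpos := mul_pos hs0 χ.rOut_pos
    refine le_trans ?_ (measureReal_mono hsub hfin)
    rw [measureReal_union _ measurableSet_Ioc measure_Icc_lt_top.ne measure_Ioc_lt_top.ne,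
      Real.volume_real_Icc_of_le (by linarith), Real.volume_real_Ioc_of_le hsin, hin, hout]
    · have h1 : r * η ≤ r * (δ * (1 - s)) := by gcongr
      have h2 : 0 ≤ r * s * η := by positivity
      nlinarith
    · exact Set.disjoint_left.2 fun x hx hx' => by linarith [hx.2, hx'.1]

theorem exists_isLaminate {l m δ a b : ℝ} (hl : 0 < l) (hm : 0 < m) (hδ : 0 < δ) (hab : a < b) :
    ∃ g f k, IsLaminate l m δ a b g f k := by
  obtain ⟨n, hn⟩ := exists_nat_gt (max (b - a) ((l + m) * (b - a) / δ))
  have hba : 0 < b - a := sub_pos.2 hab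
  have hn0 : (0 : ℝ) < n := hba.trans ((le_max_left _ _).trans_lt hn)
  obtain ⟨r, hr⟩ : ∃ r, r = (b - a) / n / 2 := ⟨_, rfl⟩
  have h2r : 2 * r = (b - a) / n := by rw [hr]; ring
  have hr0 : 0 < r := by rw [hr]; positivity
  have hr1 : 2 * r ≤ 1 := by
    rw [h2r, div_le_one hn0]
    exact (le_max_left _ _).trans hn.le
  have hrδ : (l + m) * (2 * r) ≤ δ := by
    have := (le_max_right (b - a) _).trans hn.le
    rw [div_le_iff₀ hδ] at this
    rw [h2r, ← mul_div_assoc, div_le_iff₀ hn0]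
    linarith
  obtain ⟨g, f, k, h⟩ := exists_isLaminate_symm hl hm hδ hr0 hr1 hrδ
  have hcell (c : ℝ) : ∃ g f k, IsLaminate l m δ c (c + 2 * r) g f k := by
    have := h.comp_sub_const (c + r)
    rw [show -r + (c + r) = c by ring, show r + (c + r) = c + 2 * r by ring] at this
    exact ⟨_, _, _, this⟩
  have hind (j : ℕ) : ∃ g f k, IsLaminate l m δ a (a + (j + 1) * (2 * r)) g f k := by
    induction j with
    | zero => simpa using hcell a
    | succ j ih =>
      obtain ⟨g, f, k, h1⟩ := ih
      obtain ⟨g', f', k', h2⟩ := hcell (a + (j + 1) * (2 * r))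
      have := h1.add h2 (by have : 0 ≤ ((j : ℝ) + 1) * (2 * r) := by positivity
                            linarith) (by linarith)
      rw [show a + (j + 1) * (2 * r) + 2 * r = a + (((j + 1 : ℕ) : ℝ) + 1) * (2 * r) by
        push_cast; ring] at this
      exact ⟨_, _, _, this⟩
  obtain ⟨j, rfl⟩ := Nat.exists_eq_succ_of_ne_zero (by rintro rfl; simp at hn0 : n ≠ 0)
  have := hind j
  rwa [h2r, show a + ((j : ℝ) + 1) * ((b - a) / (j.succ : ℕ)) = b by
    push_cast; field_simp; ring] at this

theorem tsupport_mul_prod_subset (u v : ℝ → ℝ) :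
    tsupport (fun p : ℝ × ℝ => v p.2 * u p.1) ⊆ tsupport u ×ˢ tsupport v := by
  refine closure_minimal (fun p hp => ?_) ((isClosed_tsupport u).prod (isClosed_tsupport v))
  exact ⟨subset_tsupport _ (right_ne_zero_of_mul hp), subset_tsupport _ (left_ne_zero_of_mul hp)⟩

theorem abs_sub_lt_of_add_le {A B V a b e : ℝ} (hAB : A + B ≤ V) (hab : a + b = V)
    (hA : a - e < A) (hB : b - e < B) : |A - a| < e ∧ |B - b| < e :=
  ⟨abs_lt.2 ⟨by linarith, by linarith⟩, abs_lt.2 ⟨by linarith, by linarith⟩⟩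

/-- Lemma 3.5: rank-one smooth approximation on a rectangle. -/
theorem stmt9
    (x1 x2 t1 t2 : ℝ) (hx : x1 < x2) (ht : t1 < t2)
    (lam1 lam2 ε : ℝ) (hlam1 : 0 < lam1) (hlam2 : 0 < lam2) (hε : 0 < ε) :
    ∃ φ ψ : ℝ → ℝ → ℝ,
      let Q : Set (ℝ × ℝ) := Set.Ioo x1 x2 ×ˢ Set.Ioo t1 t2;
      -- ω = (φ,ψ) ∈ C_c^∞(Q;ℝ²)
      ContDiff ℝ (⊤ : ℕ∞) (uc φ) ∧ ContDiff ℝ (⊤ : ℕ∞) (uc ψ) ∧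
      HasCompactSupport (uc φ) ∧ HasCompactSupport (uc ψ) ∧
      tsupport (uc φ) ⊆ Q ∧ tsupport (uc ψ) ⊆ Q ∧
      -- (a)
      (∀ p : ℝ × ℝ, p ∈ Q →
        |φ p.1 p.2| < ε ∧ |ψ p.1 p.2| < ε ∧
        |pdt φ p.1 p.2| < ε ∧ |pdt ψ p.1 p.2| < ε) ∧
      -- (b)
      (∀ p : ℝ × ℝ, p ∈ Q → -lam1 ≤ pdx φ p.1 p.2 ∧ pdx φ p.1 p.2 ≤ lam2) ∧
      -- (c)
      |(volume {p : ℝ × ℝ | p ∈ Q ∧ pdx φ p.1 p.2 = -lam1}).toReal -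
          lam2 / (lam1 + lam2) * ((x2 - x1) * (t2 - t1))| < ε ∧
      |(volume {p : ℝ × ℝ | p ∈ Q ∧ pdx φ p.1 p.2 = lam2}).toReal -
          lam1 / (lam1 + lam2) * ((x2 - x1) * (t2 - t1))| < ε ∧
      -- (d)
      (∀ p : ℝ × ℝ, p ∈ Q → pdx ψ p.1 p.2 = φ p.1 p.2) ∧
      -- (e)
      (∀ t ∈ Set.Ioo t1 t2, ∫ x in x1..x2, φ x t = 0) := by
  have hT : 0 < t2 - t1 := sub_pos.2 ht
  have hL : 0 < x2 - x1 := sub_pos.2 hx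
  have hlam : 0 < lam1 + lam2 := by positivity
  obtain ⟨V, hV⟩ : ∃ V, V = (x2 - x1) * (t2 - t1) := ⟨_, rfl⟩
  have hV0 : 0 < V := by rw [hV]; positivity
  obtain ⟨e, he0, he1, heV⟩ : ∃ e, 0 < e ∧ e < 1 ∧ 2 * e * V < ε := by
    refine ⟨min (1 / 2) (ε / (4 * V)), by positivity,
      (min_le_left _ _).trans_lt (by norm_num), ?_⟩
    have := min_le_right (1 / 2) (ε / (4 * V))
    rw [le_div_iff₀ (by positivity)] at this
    linarith
  let χ : ContDiffBump ((t1 + t2) / 2 : ℝ) :=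
    ⟨(t2 - t1) / 2 * (1 - e), (t2 - t1) / 2 * (1 - e / 2),
      mul_pos (by linarith) (by linarith), by nlinarith⟩
  have hin : χ.rIn = (t2 - t1) / 2 * (1 - e) := rfl
  have hout : χ.rOut = (t2 - t1) / 2 * (1 - e / 2) := rfl
  have hχsupp : tsupport χ ⊆ Ioo t1 t2 := by
    rw [χ.tsupport_eq, Real.closedBall_eq_Icc, hout]
    exact Icc_subset_Ioo (by nlinarith) (by nlinarith)
  obtain ⟨C, hC⟩ : ∃ C, ∀ t, ‖deriv χ t‖ ≤ C :=
    χ.hasCompactSupport.deriv.exists_bound_of_continuous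
      ((χ.contDiff (n := 1)).continuous_deriv le_rfl)
  have hC0 : 0 ≤ C := (norm_nonneg _).trans (hC 0)
  obtain ⟨δ, hδ0, hδe, hδε, hδC⟩ : ∃ δ, 0 < δ ∧ δ ≤ e ∧ δ < ε ∧ C * δ < ε := by
    refine ⟨min e (ε / (2 * (C + 1))), by positivity, min_le_left _ _, ?_, ?_⟩ <;>
    · have h1 := min_le_right e (ε / (2 * (C + 1)))
      have h2 : 0 < min e (ε / (2 * (C + 1))) := by positivity
      rw [le_div_iff₀ (by positivity)] at h1
      nlinarith
  obtain ⟨g, f, k, h⟩ := exists_isLaminate hlam1 hlam2 hδ0 hx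
  have hf : ContDiff ℝ (⊤ : ℕ∞) f := contDiff_infty_of_hasDerivAt h.hasDerivAt' h.contDiff
  have hg : ContDiff ℝ (⊤ : ℕ∞) g := contDiff_infty_of_hasDerivAt h.hasDerivAt hf
  have hpdx {u u' : ℝ → ℝ} (hu : ∀ x, HasDerivAt u (u' x) x) (x t : ℝ) :
      pdx (fun x t => χ t * u x) x t = χ t * u' x := ((hu x).const_mul (χ t)).deriv
  have hsmooth {u : ℝ → ℝ} (hu : ContDiff ℝ (⊤ : ℕ∞) u) :
      ContDiff ℝ (⊤ : ℕ∞) (uc fun x t => χ t * u x) :=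
    (χ.contDiff.comp contDiff_snd).mul (hu.comp contDiff_fst)
  have hcpt {u : ℝ → ℝ} (hu : tsupport u ⊆ Ioo x1 x2) :
      HasCompactSupport (uc fun x t => χ t * u x) :=
    ((isCompact_Icc.of_isClosed_subset (isClosed_tsupport u)
      (hu.trans Ioo_subset_Icc_self)).prod χ.hasCompactSupport).of_isClosed_subset
      (isClosed_tsupport _) (tsupport_mul_prod_subset u χ)
  have hsupp {u : ℝ → ℝ} (hu : tsupport u ⊆ Ioo x1 x2) :
      tsupport (uc fun x t => χ t * u x) ⊆ Ioo x1 x2 ×ˢ Ioo t1 t2 :=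
    (tsupport_mul_prod_subset u χ).trans (prod_mono hu hχsupp)
  have hbound {u : ℝ → ℝ} (hu : ∀ x, |u x| ≤ δ) (x t : ℝ) : |χ t * u x| < ε := by
    rw [abs_mul, abs_of_nonneg χ.nonneg]
    exact (mul_le_of_le_one_left (abs_nonneg _) χ.le_one).trans_lt ((hu x).trans_lt hδε)
  have hbound_pdt {u : ℝ → ℝ} (hu : ∀ x, |u x| ≤ δ) (x t : ℝ) :
      |pdt (fun x t => χ t * u x) x t| < ε := by
    have hd : HasDerivAt χ (deriv χ t) t :=
      ((χ.contDiff (n := 1)).differentiable one_ne_zero t).hasDerivAt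
    rw [show pdt (fun x t => χ t * u x) x t = deriv χ t * u x from (hd.mul_const (u x)).deriv,
      abs_mul]
    exact (mul_le_mul (hC t) (hu x) (abs_nonneg _) hC0).trans_lt hδC
  refine ⟨fun x t => χ t * f x, fun x t => χ t * g x, hsmooth hf, hsmooth hg,
    hcpt h.tsupport_subset', hcpt h.tsupport_subset, hsupp h.tsupport_subset',
    hsupp h.tsupport_subset, fun p _ => ⟨hbound h.abs_le' _ _, hbound h.abs_le _ _,
      hbound_pdt h.abs_le' _ _, hbound_pdt h.abs_le _ _⟩, fun p _ => ?_, ?_⟩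
  · rw [hpdx h.hasDerivAt']
    have h0 := χ.nonneg (x := p.2)
    have h1 := χ.le_one (x := p.2)
    obtain ⟨h2, h3⟩ := h.mem_Icc p.1
    constructor <;> nlinarith
  simp only [hpdx h.hasDerivAt', hpdx h.hasDerivAt]
  have hQ : volume (Ioo x1 x2 ×ˢ Ioo t1 t2) ≠ ∞ := by
    rw [Measure.volume_eq_prod, Measure.prod_prod, Real.volume_Ioo, Real.volume_Ioo]
    finiteness
  have hQV : volume.real (Ioo x1 x2 ×ˢ Ioo t1 t2) = V := by
    rw [Measure.volume_eq_prod, measureReal_prod_prod, Real.volume_real_Ioo_of_le hx.le,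
      Real.volume_real_Ioo_of_le ht.le, hV]
  let S : ℝ → Set (ℝ × ℝ) := fun v => {p | p ∈ Ioo x1 x2 ×ˢ Ioo t1 t2 ∧ χ p.2 * k p.1 = v}
  have hSQ (v : ℝ) : S v ⊆ Ioo x1 x2 ×ˢ Ioo t1 t2 := fun p hp => hp.1
  have hSfin (v : ℝ) : volume (S v) ≠ ∞ := measure_ne_top_of_subset (hSQ v) hQ
  have hSmeas (v : ℝ) : MeasurableSet (S v) :=
    (measurableSet_Ioo.prod measurableSet_Ioo).inter
      (((χ.continuous.comp continuous_snd).mul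
        (h.contDiff.continuous.comp continuous_fst)).measurable (measurableSet_singleton v))
  have hSvol {v θ : ℝ} (hθ0 : 0 ≤ θ) (hθ1 : θ ≤ 1)
      (hv : (1 - δ) * θ * (x2 - x1) ≤ volume.real {x | x ∈ Ioo x1 x2 ∧ k x = v}) :
      θ * V - ε < volume.real (S v) := by
    have hsub : {x | x ∈ Ioo x1 x2 ∧ k x = v} ×ˢ Metric.closedBall ((t1 + t2) / 2) χ.rIn ⊆ S v := by
      rintro ⟨x, t⟩ ⟨⟨hxm, hxv⟩, htm⟩
      have h1 : χ t = 1 := χ.one_of_mem_closedBall htm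
      refine ⟨⟨hxm, hχsupp (subset_tsupport _ ?_)⟩, ?_⟩
      · simp [h1]
      · simpa [h1] using hxv
    refine lt_of_lt_of_le ?_ (measureReal_mono hsub (hSfin v))
    rw [Measure.volume_eq_prod, measureReal_prod_prod, Real.closedBall_eq_Icc,
      Real.volume_real_Icc_of_le (by linarith [χ.rIn_pos])]
    have h1 : (1 - e) * θ * (x2 - x1) ≤ (1 - δ) * θ * (x2 - x1) := by gcongr
    have h2 : (1 - e) * θ * (x2 - x1) * ((t2 - t1) * (1 - e)) ≤
        volume.real {x | x ∈ Ioo x1 x2 ∧ k x = v} * ((t2 - t1) * (1 - e)) :=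
      mul_le_mul_of_nonneg_right (h1.trans hv) (mul_nonneg hT.le (by linarith))
    rw [show (t1 + t2) / 2 + χ.rIn - ((t1 + t2) / 2 - χ.rIn) = (t2 - t1) * (1 - e) by
      rw [hin]; ring]
    refine lt_of_lt_of_le ?_ h2
    rw [show (1 - e) * θ * (x2 - x1) * ((t2 - t1) * (1 - e)) = θ * V * (1 - e) ^ 2 by
      rw [hV]; ring]
    have h3 : θ * (e * V) ≤ e * V := mul_le_of_le_one_left (by positivity) hθ1
    nlinarith [mul_nonneg (mul_nonneg hθ0 hV0.le) (sq_nonneg e)]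
  have hsum : volume.real (S (-lam1)) + volume.real (S lam2) ≤ V := by
    rw [← measureReal_union _ (hSmeas lam2) (hSfin _) (hSfin _), ← hQV]
    · exact measureReal_mono (union_subset (hSQ _) (hSQ _)) hQ
    · refine Set.disjoint_left.2 fun p hp hp' => ?_
      linarith [hp.2.symm.trans hp'.2]
  have hθ : lam2 / (lam1 + lam2) * V + lam1 / (lam1 + lam2) * V = V := by field_simp; ring
  obtain ⟨hA, hB⟩ := abs_sub_lt_of_add_le hsum hθ
    (hSvol (by positivity) (by rw [div_le_one hlam]; linarith) h.le_volume_lower)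
    (hSvol (by positivity) (by rw [div_le_one hlam]; linarith) h.le_volume_upper)
  rw [← hV]
  refine ⟨hA, hB, fun p _ => trivial, fun t _ => ?_⟩
  rw [intervalIntegral.integral_const_mul, intervalIntegral.integral_eq_sub_of_hasDerivAt
    (fun x _ => h.hasDerivAt x) (hf.continuous.intervalIntegrable _ _),
    (h.eq_zero (by simp)).1, (h.eq_zero (by simp)).1, sub_zero, mul_zero]
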